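/- arXiv:2507.05164 — 2 statements merged into one kernel-verified Lean document; each statement's English description precedes it below -/
import Mathlib

section
/- Let k ≥ 2 and fix an augmented scalar MLP architecture: layer widths d = d_0, …, d_L = 1 and intermediate widths m_0, …, m_{L−1} such that the maximal width strictly exceeds d and the sequence of widths is non-decreasing up to the layer of maximal width and non-increasing afterwards; fix the activation functions and arbitrary biases b_l, b̃_l. Then the set of weight-matrix tuples (W_0, W̃_0, …, W_{L−1}, W̃_{L−1}) for which the resulting map Φ : ℝ^d → ℝ has a degenerate critical point has Lebesgue measure zero in the weight space; equivalently, for Lebesgue-almost every choice of weight matrices, Φ is of class (C1) or (C2), in particular a Morse function. -/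
/-- The layers of a multilayer perceptron: `h_0 = x`,
`h_{l+1} = V_l · σ_l(W_l · h_l + b_l) + c_l`. -/
noncomputable def mlpMap (d m : ℕ → ℕ)
    (W : ∀ l : ℕ, Matrix (Fin (m l)) (Fin (d l)) ℝ)
    (V : ∀ l : ℕ, Matrix (Fin (d (l+1))) (Fin (m l)) ℝ)
    (b : ∀ l : ℕ, Fin (m l) → ℝ)
    (c : ∀ l : ℕ, Fin (d (l+1)) → ℝ)
    (σ : ∀ l : ℕ, Fin (m l) → ℝ → ℝ) :
    (L : ℕ) → (Fin (d 0) → ℝ) → (Fin (d L) → ℝ)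
  | 0, x => x
  | (L+1), x =>
      (V L).mulVec
        (fun i => σ L i (((W L).mulVec (mlpMap d m W V b c σ L x)) i + b L i)) + c L

/-- The Hessian matrix of a scalar function on `ℝ^n`, via the second iterated
Fréchet derivative. -/
noncomputable def hessPi {n : ℕ} (f : (Fin n → ℝ) → ℝ) (p : Fin n → ℝ) :
    Matrix (Fin n) (Fin n) ℝ :=
  Matrix.of fun i j =>
    iteratedFDeriv ℝ 2 f p ![Pi.single i (1:ℝ), Pi.single j (1:ℝ)]

open MeasureTheory Topology

lemma exists_compl_map {V Y E : Type*} [AddCommGroup V] [Module ℝ V] [FiniteDimensional ℝ V]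
    [AddCommGroup Y] [Module ℝ Y] [FiniteDimensional ℝ Y]
    [AddCommGroup E] [Module ℝ E] [FiniteDimensional ℝ E]
    (hdim : Module.finrank ℝ V = Module.finrank ℝ Y + Module.finrank ℝ E)
    (A : V →ₗ[ℝ] Y) (hA : A.range = ⊤) :
    ∃ T : V →ₗ[ℝ] E, Function.Injective (A.prod T) := by
  have h1 := A.finrank_range_add_finrank_ker
  rw [hA, finrank_top] at h1
  have h2 : Module.finrank ℝ A.ker = Module.finrank ℝ E := by omega
  obtain ⟨T0, hT0⟩ := LinearMap.exists_extend (LinearMap.id : A.ker →ₗ[ℝ] A.ker)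
  let i := LinearEquiv.ofFinrankEq _ _ h2
  refine ⟨i.toLinearMap ∘ₗ T0, ?_⟩
  rw [← LinearMap.ker_eq_bot, LinearMap.ker_eq_bot']
  intro z hz
  have ha : A z = 0 := congrArg Prod.fst hz
  have hb : i (T0 z) = 0 := congrArg Prod.snd hz
  have hb' : T0 z = 0 := by simpa using hb
  have := LinearMap.congr_fun hT0 ⟨z, ha⟩
  simp only [LinearMap.comp_apply, Submodule.subtype_apply, LinearMap.id_apply] at this
  rw [hb'] at this
  exact (congrArg Subtype.val this).symm

lemma param_sard {E X Y : Type*} [NormedAddCommGroup E] [NormedSpace ℝ E] [FiniteDimensional ℝ E]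
    [NormedAddCommGroup X] [NormedSpace ℝ X] [FiniteDimensional ℝ X]
    [NormedAddCommGroup Y] [NormedSpace ℝ Y] [FiniteDimensional ℝ Y]
    [MeasurableSpace E] [BorelSpace E] (μ : Measure E) [μ.IsAddHaarMeasure]
    (hdim : Module.finrank ℝ X = Module.finrank ℝ Y)
    (F : E × X → Y) (hF : ContDiff ℝ 1 F) :
    μ {w | ∃ x, F (w, x) = 0 ∧ (fderiv ℝ F (w, x)).toLinearMap.range = ⊤ ∧
      ∃ v, v ≠ 0 ∧ fderiv ℝ F (w, x) (0, v) = 0} = 0 := by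
  set Z : Set (E × X) := {z | F z = 0 ∧ (fderiv ℝ F z).toLinearMap.range = ⊤ ∧
      ∃ v : X, v ≠ 0 ∧ fderiv ℝ F z (0, v) = 0} with hZ
  have hcomap : OuterMeasure.comap Prod.fst μ.toOuterMeasure Z = 0 := by
    haveI : SecondCountableTopology (E × X) :=
      haveI := FiniteDimensional.proper ℝ (E × X)
      inferInstance
    refine measure_null_of_locally_null Z fun z0 hz0 => ?_
    obtain ⟨T, hT⟩ := exists_compl_map (E := E) (by simp [hdim, add_comm])
      (fderiv ℝ F z0).toLinearMap hz0.2.1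
    let Tc : E × X →L[ℝ] E := T.toContinuousLinearMap
    let H : E × X → Y × E := fun z => (F z, Tc z)
    have hH : ContDiff ℝ 1 H := hF.prodMk Tc.contDiff
    have hHd : ∀ z, HasFDerivAt H ((fderiv ℝ F z).prod Tc) z := fun z =>
      ((hF.differentiable one_ne_zero z).hasFDerivAt).prodMk Tc.hasFDerivAt
    have hfd : ∀ z, fderiv ℝ H z = (fderiv ℝ F z).prod Tc := fun z => (hHd z).fderiv
    let e0 : (E × X) ≃L[ℝ] (Y × E) := (LinearEquiv.ofInjectiveOfFinrankEq
      ((fderiv ℝ F z0).toLinearMap.prod T) hT (by simp [hdim, add_comm])).toContinuousLinearEquiv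
    have he0 : (e0 : (E × X) →L[ℝ] (Y × E)) = fderiv ℝ H z0 := by
      rw [hfd]; ext z <;> rfl
    have hst : HasStrictFDerivAt H (e0 : (E × X) →L[ℝ] (Y × E)) z0 := by
      rw [he0]; exact hH.contDiffAt.hasStrictFDerivAt one_ne_zero
    let e := hst.toOpenPartialHomeomorph H
    have hecoe : (e : E × X → Y × E) = H := hst.toOpenPartialHomeomorph_coe
    have hsrc : z0 ∈ e.source := hst.mem_toOpenPartialHomeomorph_source
    have hcont : Continuous (fderiv ℝ H) := hH.continuous_fderiv one_ne_zero
    have hinv : {z | fderiv ℝ H z ∈ Set.range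
        (ContinuousLinearEquiv.toContinuousLinearMap : ((E × X) ≃L[ℝ] (Y × E)) → _)} ∈ 𝓝 z0 := by
      apply hcont.continuousAt
      rw [← he0]
      exact e0.nhds
    refine ⟨Z ∩ (e.source ∩ {z | fderiv ℝ H z ∈ Set.range
        (ContinuousLinearEquiv.toContinuousLinearMap : ((E × X) ≃L[ℝ] (Y × E)) → _)}),
        Filter.inter_mem self_mem_nhdsWithin (mem_nhdsWithin_of_mem_nhds
          (Filter.inter_mem (e.open_source.mem_nhds hsrc) hinv)), ?_⟩
    rw [OuterMeasure.comap_apply]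
    set U := Z ∩ (e.source ∩ {z | fderiv ℝ H z ∈ Set.range
        (ContinuousLinearEquiv.toContinuousLinearMap : ((E × X) ≃L[ℝ] (Y × E)) → _)}) with hU
    let φ : E → E := fun t => (e.symm (0, t)).1
    have himg : Prod.fst '' U ⊆ φ '' (Set.image Tc U) := by
      rintro _ ⟨z, hz, rfl⟩
      refine ⟨Tc z, ⟨z, hz, rfl⟩, ?_⟩
      have : ((0 : Y), Tc z) = e z := by rw [hecoe]; simp only [H]; rw [hz.1.1]
      simp only [φ]
      rw [this, e.left_inv hz.2.1]
    refine measure_mono_null himg ?_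
    have hder : ∀ t ∈ Set.image Tc U, ∃ φ' : E →L[ℝ] E, HasFDerivAt φ φ' t ∧ φ'.det = 0 := by
      rintro _ ⟨z, ⟨⟨hz0, -, v, hv, hv0⟩, hzs, ez, hez⟩, rfl⟩
      have hHz : e z = ((0 : Y), Tc z) := by rw [hecoe]; simp only [H]; rw [hz0]
      have h1 : HasFDerivAt e.symm (ez.symm : (Y × E) →L[ℝ] (E × X)) (e z) := by
        apply e.hasFDerivAt_symm (e.map_source hzs)
        rw [e.left_inv hzs, hez, hecoe]
        exact (hH.differentiable one_ne_zero z).hasFDerivAt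
      rw [hHz] at h1
      have h2 : HasFDerivAt (fun t : E => ((0 : Y), t)) (ContinuousLinearMap.inr ℝ Y E) (Tc z) :=
        (ContinuousLinearMap.inr ℝ Y E).hasFDerivAt
      have h3 := (ContinuousLinearMap.fst ℝ E X).hasFDerivAt.comp (Tc z) (h1.comp (Tc z) h2)
      refine ⟨_, h3, ?_⟩
      have hzv : ez (0, v) = (0, Tc (0, v)) := by
        have : ez (0, v) = fderiv ℝ H z (0, v) := by rw [← hez]; rfl
        rw [this, hfd, ContinuousLinearMap.prod_apply, hv0]
      by_contra hdet
      have hTv : Tc (0, v) ≠ 0 := by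
        intro h0
        rw [h0] at hzv
        have : ((0 : E), v) = 0 := ez.injective (by rw [hzv, map_zero]; rfl)
        exact hv (congrArg Prod.snd this)
      have hinj := LinearMap.ker_eq_bot.mp
        ((LinearMap.isUnit_iff_ker_eq_bot _).mp ((LinearMap.isUnit_iff_isUnit_det _).mpr
          (isUnit_iff_ne_zero.mpr hdet)))
      apply hTv
      apply hinj
      rw [map_zero]
      change (ez.symm (0, Tc (0, v))).1 = 0
      rw [← hzv, ez.symm_apply_apply]
    choose! φ' hφ1 hφ2 using hder
    exact addHaar_image_eq_zero_of_det_fderivWithin_eq_zero μ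
      (fun t ht => (hφ1 t ht).hasFDerivWithinAt) hφ2
  rw [OuterMeasure.comap_apply] at hcomap
  refine measure_mono_null ?_ hcomap
  rintro w ⟨x, hx⟩
  exact ⟨(w, x), hx, rfl⟩

/-- A surjective linear family of tall matrices is almost surely injective. -/
lemma ae_injective {E : Type*} [NormedAddCommGroup E] [NormedSpace ℝ E] [FiniteDimensional ℝ E]
    [MeasurableSpace E] [BorelSpace E] (μ : Measure E) [μ.IsAddHaarMeasure]
    {m n : ℕ} (hnm : n ≤ m) (π : E →L[ℝ] (Fin m → Fin n → ℝ)) (hπ : Function.Surjective π) :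
    μ {w | ∃ v : Fin n → ℝ, v ≠ 0 ∧ (Matrix.of (π w)).mulVec v = 0} = 0 := by
  let F : E × (Fin n → ℝ) → (Fin n → ℝ) := fun z i => ∑ j, π z.1 (Fin.castLE hnm i) j * z.2 j
  have hd : ∀ z : E × (Fin n → ℝ), HasFDerivAt F (ContinuousLinearMap.pi fun i =>
      ∑ j, (π z.1 (Fin.castLE hnm i) j • ((ContinuousLinearMap.proj j).comp
        (ContinuousLinearMap.snd ℝ E (Fin n → ℝ))) +
        z.2 j • ((ContinuousLinearMap.proj (R := ℝ) (φ := fun _ : Fin n => ℝ) j).comp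
          ((ContinuousLinearMap.proj (R := ℝ) (φ := fun _ : Fin m => (Fin n → ℝ))
            (Fin.castLE hnm i)).comp
          (π.comp (ContinuousLinearMap.fst ℝ E (Fin n → ℝ))))))) z := by
    intro z
    rw [hasFDerivAt_pi]
    intro i
    refine HasFDerivAt.fun_sum fun j _ => ?_
    exact HasFDerivAt.mul
      ((ContinuousLinearMap.proj (R := ℝ) (φ := fun _ : Fin n => ℝ) j).comp
          ((ContinuousLinearMap.proj (R := ℝ) (φ := fun _ : Fin m => (Fin n → ℝ))
            (Fin.castLE hnm i)).comp
          (π.comp (ContinuousLinearMap.fst ℝ E (Fin n → ℝ))))).hasFDerivAt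
      ((ContinuousLinearMap.proj (R := ℝ) (φ := fun _ : Fin n => ℝ) j).comp
        (ContinuousLinearMap.snd ℝ E (Fin n → ℝ))).hasFDerivAt
  have hF : ContDiff ℝ 1 F := by
    rw [contDiff_pi]
    intro i
    refine ContDiff.sum fun j _ => ?_
    exact (((ContinuousLinearMap.proj (R := ℝ) (φ := fun _ : Fin n => ℝ) j).comp
          ((ContinuousLinearMap.proj (R := ℝ) (φ := fun _ : Fin m => (Fin n → ℝ))
            (Fin.castLE hnm i)).comp
          (π.comp (ContinuousLinearMap.fst ℝ E (Fin n → ℝ))))).contDiff).mul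
      ((ContinuousLinearMap.proj (R := ℝ) (φ := fun _ : Fin n => ℝ) j).comp
        (ContinuousLinearMap.snd ℝ E (Fin n → ℝ))).contDiff
  refine measure_mono_null ?_ (param_sard μ rfl F hF)
  rintro w ⟨v, hv, hv0⟩
  have hrow : ∀ i, ∑ j, π w i j * v j = 0 := fun i => congrFun hv0 i
  refine ⟨v, funext fun i => hrow _, ?_, v, hv, ?_⟩
  · rw [(hd (w, v)).fderiv, LinearMap.range_eq_top]
    intro y
    obtain ⟨j0, hj0⟩ : ∃ j, v j ≠ 0 := by
      by_contra! h
      exact hv (funext h)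
    obtain ⟨δ, hδ⟩ := hπ (fun i j => if h : (i : ℕ) < n then
      (if j = j0 then y ⟨i, h⟩ / v j0 else 0) else 0)
    refine ⟨(δ, 0), funext fun i => ?_⟩
    simp only [ContinuousLinearMap.coe_coe, ContinuousLinearMap.pi_apply,
      _root_.sum_apply, _root_.add_apply, _root_.smul_apply,
      ContinuousLinearMap.comp_apply, ContinuousLinearMap.coe_fst', ContinuousLinearMap.coe_snd',
      ContinuousLinearMap.proj_apply, hδ]
    simp [hj0, mul_div_cancel₀]
  · rw [(hd (w, v)).fderiv]
    funext i
    simpa using hrow (Fin.castLE hnm i)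

section MLPMorse

lemma hasFDerivAt_mulVec {X : Type*} [NormedAddCommGroup X] [NormedSpace ℝ X] {n m : ℕ}
    {h : X → Fin n → ℝ} {h' : X →L[ℝ] (Fin n → ℝ)} {x : X} (hh : HasFDerivAt h h' x)
    (A : Matrix (Fin m) (Fin n) ℝ) :
    HasFDerivAt (fun x => A.mulVec (h x))
      ((LinearMap.toContinuousLinearMap A.mulVecLin).comp h') x :=
  (LinearMap.toContinuousLinearMap A.mulVecLin).hasFDerivAt.comp x hh

lemma contDiff_mulVec {n m : ℕ} (A : Matrix (Fin m) (Fin n) ℝ) {k : WithTop ℕ∞} :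
    ContDiff ℝ k (fun y : Fin n → ℝ => A.mulVec y) :=
  (LinearMap.toContinuousLinearMap A.mulVecLin).contDiff

lemma hasFDerivAt_act {m : ℕ} (s : Fin m → ℝ → ℝ) (hs : ∀ i, Differentiable ℝ (s i))
    (b : Fin m → ℝ) (y : Fin m → ℝ) :
    HasFDerivAt (fun (y : Fin m → ℝ) i => s i (y i + b i))
      (ContinuousLinearMap.pi fun i => deriv (s i) (y i + b i) •
        (ContinuousLinearMap.proj (R := ℝ) (φ := fun _ : Fin m => ℝ) i)) y := by
  rw [hasFDerivAt_pi]
  intro i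
  have h1 : HasFDerivAt (fun y : Fin m → ℝ => y i + b i)
      (ContinuousLinearMap.proj (R := ℝ) (φ := fun _ : Fin m => ℝ) i) y :=
    (ContinuousLinearMap.proj (R := ℝ) (φ := fun _ : Fin m => ℝ) i).hasFDerivAt.add_const _
  exact (hs i _).hasDerivAt.comp_hasFDerivAt y h1

lemma functional_comp_ne_zero {n m : ℕ} (A : Matrix (Fin m) (Fin n) ℝ)
    (hA : ∀ v, A.transpose.mulVec v = 0 → v = 0) (a : (Fin m → ℝ) →L[ℝ] ℝ) (ha : a ≠ 0) :
    a.comp (LinearMap.toContinuousLinearMap A.mulVecLin) ≠ 0 := by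
  intro h0
  have hexp : ∀ y : Fin m → ℝ, a y = ∑ i, y i * a (Pi.single i 1) := by
    intro y
    conv_lhs => rw [pi_eq_sum_univ' y]
    rw [map_sum]
    refine Finset.sum_congr rfl fun i _ => ?_
    rw [map_smul, smul_eq_mul]
  have hu := hA (fun i => a (Pi.single i 1)) (by
    funext j
    have := congrArg (fun f : (Fin n → ℝ) →L[ℝ] ℝ => f (Pi.single j 1)) h0
    simp only [ContinuousLinearMap.comp_apply, LinearMap.coe_toContinuousLinearMap',
      Matrix.mulVecLin_apply, _root_.zero_apply] at this
    rw [hexp] at this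
    simpa [Matrix.mulVec, dotProduct, Pi.single_apply] using this)
  apply ha
  ext y
  rw [hexp]
  have : ∀ i, a (Pi.single i 1) = 0 := fun i => congrFun hu i
  simp [this]

lemma key_step {X : Type*} [NormedAddCommGroup X] [NormedSpace ℝ X] {n m : ℕ}
    (h : X → Fin n → ℝ) (h' : X →L[ℝ] (Fin n → ℝ)) (x ξ : X) (hh : HasFDerivAt h h' x)
    (Ψ : (Fin m → ℝ) → ℝ) (hΨ : ContDiff ℝ 1 Ψ) (A : Matrix (Fin m) (Fin n) ℝ)
    (hA : A.mulVec (h' ξ) = 0) (hu : fderiv ℝ Ψ (A.mulVec (h x)) ≠ 0)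
    (hvar : ∀ δ : Matrix (Fin m) (Fin n) ℝ,
      HasDerivAt (fun t : ℝ => fderiv ℝ (fun x => Ψ ((A + t • δ).mulVec (h x))) x ξ) 0 0) :
    h' ξ = 0 := by
  by_contra hne
  obtain ⟨j, hj⟩ : ∃ j, h' ξ j ≠ 0 := by
    by_contra! h0
    exact hne (funext h0)
  obtain ⟨e, he⟩ : ∃ e, fderiv ℝ Ψ (A.mulVec (h x)) e ≠ 0 := by
    by_contra! h0
    exact hu (ContinuousLinearMap.ext h0)
  let δ : Matrix (Fin m) (Fin n) ℝ := fun i k => if k = j then e i / h' ξ j else 0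
  have hδ : δ.mulVec (h' ξ) = e := by
    funext i
    simp [δ, Matrix.mulVec, dotProduct, hj]
  have hG : ∀ t : ℝ, fderiv ℝ (fun x => Ψ ((A + t • δ).mulVec (h x))) x ξ =
      t * fderiv ℝ Ψ ((A + t • δ).mulVec (h x)) e := by
    intro t
    have h1 := (hΨ.differentiable one_ne_zero ((A + t • δ).mulVec (h x))).hasFDerivAt.comp x
      (hasFDerivAt_mulVec hh (A + t • δ))
    have h2 := h1.fderiv
    simp only [Function.comp_def] at h2
    rw [h2]
    simp [Matrix.add_mulVec, Matrix.smul_mulVec, hA, hδ]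
  have h1 := hvar δ
  simp only [hG] at h1
  rw [hasDerivAt_iff_tendsto_slope] at h1
  have hcont : Continuous (fun t : ℝ => fderiv ℝ Ψ ((A + t • δ).mulVec (h x)) e) := by
    have hc1 : Continuous (fun t : ℝ => (A + t • δ).mulVec (h x)) := by
      simp only [Matrix.add_mulVec, Matrix.smul_mulVec]
      fun_prop
    exact ((hΨ.continuous_fderiv one_ne_zero).comp hc1).clm_apply continuous_const
  have h2 : Filter.Tendsto (fun t : ℝ => fderiv ℝ Ψ ((A + t • δ).mulVec (h x)) e) (𝓝[≠] 0)
      (𝓝 (fderiv ℝ Ψ (A.mulVec (h x)) e)) := by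
    have := (hcont.tendsto 0).mono_left (nhdsWithin_le_nhds (s := {0}ᶜ))
    simpa using this
  have h3 : Filter.Tendsto (fun t : ℝ => fderiv ℝ Ψ ((A + t • δ).mulVec (h x)) e) (𝓝[≠] 0)
      (𝓝 0) := by
    refine h1.congr' ?_
    filter_upwards [self_mem_nhdsWithin] with t ht
    have ht' : t ≠ 0 := ht
    simp [slope, ht']
  exact he (tendsto_nhds_unique h2 h3)

/-- The space of weight tuples. -/
abbrev Wts (L : ℕ) (d m : ℕ → ℕ) : Type :=
  ∀ l : Fin L, (Fin (m l) → Fin (d l) → ℝ) × (Fin (d (l+1)) → Fin (m l) → ℝ)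

def WM {L : ℕ} {d m : ℕ → ℕ} (w : Wts L d m) (l : ℕ) : Matrix (Fin (m l)) (Fin (d l)) ℝ :=
  if h : l < L then Matrix.of (w ⟨l, h⟩).1 else 0

def VM {L : ℕ} {d m : ℕ → ℕ} (w : Wts L d m) (l : ℕ) : Matrix (Fin (d (l+1))) (Fin (m l)) ℝ :=
  if h : l < L then Matrix.of (w ⟨l, h⟩).2 else 0

/-- The matrices of the architecture all have full rank in the required sense. -/
def Gen {L : ℕ} {d m : ℕ → ℕ} (J : ℕ) (w : Wts L d m) : Prop :=
  ∀ l < L, (2 * l < J → ∀ v, (WM w l).mulVec v = 0 → v = 0) ∧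
    (J ≤ 2 * l → ∀ v, (WM w l).transpose.mulVec v = 0 → v = 0) ∧
    (2 * l + 1 < J → ∀ v, (VM w l).mulVec v = 0 → v = 0) ∧
    (J ≤ 2 * l + 1 → ∀ v, (VM w l).transpose.mulVec v = 0 → v = 0)

variable {L : ℕ} {d m : ℕ → ℕ} (b : ∀ l : ℕ, Fin (m l) → ℝ) (c : ∀ l : ℕ, Fin (d (l+1)) → ℝ)
    (σ : ∀ l : ℕ, Fin (m l) → ℝ → ℝ)

/-- hidden state -/
noncomputable def HH (w : Wts L d m) (l : ℕ) (x : Fin (d 0) → ℝ) : Fin (d l) → ℝ :=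
  mlpMap d m (WM w) (VM w) b c σ l x

/-- activation -/
def actv (l : ℕ) (y : Fin (m l) → ℝ) : Fin (m l) → ℝ := fun i => σ l i (y i + b l i)

lemma HH_succ (w : Wts L d m) (l : ℕ) (x : Fin (d 0) → ℝ) :
    HH b c σ w (l+1) x = (VM w l).mulVec (actv b σ l ((WM w l).mulVec (HH b c σ w l x))) + c l :=
  rfl

lemma WM_congr (w w' : Wts L d m) (l : ℕ) (h : ∀ i : Fin L, (i : ℕ) = l → w i = w' i) :
    WM w l = WM w' l := by
  unfold WM
  split_ifs with hl
  · rw [h ⟨l, hl⟩ rfl]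
  · rfl

lemma VM_congr (w w' : Wts L d m) (l : ℕ) (h : ∀ i : Fin L, (i : ℕ) = l → w i = w' i) :
    VM w l = VM w' l := by
  unfold VM
  split_ifs with hl
  · rw [h ⟨l, hl⟩ rfl]
  · rfl

lemma HH_congr (w w' : Wts L d m) (l : ℕ) (h : ∀ i : Fin L, (i : ℕ) < l → w i = w' i)
    (x : Fin (d 0) → ℝ) : HH b c σ w l x = HH b c σ w' l x := by
  induction l with
  | zero => rfl
  | succ l ih =>
    rw [HH_succ, HH_succ, ih fun i hi => h i (by omega),
      WM_congr w w' l fun i hi => h i (by omega), VM_congr w w' l fun i hi => h i (by omega)]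

lemma contDiff_HH (hσ : ∀ l < L, ∀ i, ContDiff ℝ 2 (σ l i)) (l : ℕ) (hl : l ≤ L) :
    ContDiff ℝ 2 (fun z : Wts L d m × (Fin (d 0) → ℝ) => HH b c σ z.1 l z.2) := by
  induction l with
  | zero => exact contDiff_snd
  | succ l ih =>
    have ih := ih (by omega)
    have hlL : l < L := by omega
    simp only [HH_succ]
    have hw : ContDiff ℝ 2 (fun z : Wts L d m × (Fin (d 0) → ℝ) => z.1 ⟨l, hlL⟩) :=
      (ContinuousLinearMap.proj (R := ℝ) (φ := fun l : Fin L =>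
        (Fin (m l) → Fin (d l) → ℝ) × (Fin (d (l+1)) → Fin (m l) → ℝ)) ⟨l, hlL⟩).contDiff.comp
        contDiff_fst
    have hW : ∀ i j, ContDiff ℝ 2 (fun z : Wts L d m × (Fin (d 0) → ℝ) => WM z.1 l i j) := by
      intro i j
      simp only [WM, hlL, dite_true, Matrix.of_apply]
      exact contDiff_pi.mp (contDiff_pi.mp (contDiff_fst.comp hw) i) j
    have hV : ∀ i j, ContDiff ℝ 2 (fun z : Wts L d m × (Fin (d 0) → ℝ) => VM z.1 l i j) := by
      intro i j
      simp only [VM, hlL, dite_true, Matrix.of_apply]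
      exact contDiff_pi.mp (contDiff_pi.mp (contDiff_snd.comp hw) i) j
    refine ContDiff.add ?_ contDiff_const
    rw [contDiff_pi]
    intro i
    simp only [Matrix.mulVec, dotProduct, actv]
    refine ContDiff.sum fun j _ => (hV i j).mul ?_
    refine (hσ l hlL j).comp (ContDiff.add ?_ contDiff_const)
    exact ContDiff.sum fun j' _ => (hW j j').mul (contDiff_pi.mp ih j')

lemma contDiff_actv (hσ : ∀ l < L, ∀ i, ContDiff ℝ 2 (σ l i)) (l : ℕ) (hl : l < L) :
    ContDiff ℝ 1 (actv b σ l) := by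
  rw [contDiff_pi]
  intro i
  exact ((hσ l hl i).of_le one_le_two).comp ((contDiff_apply ℝ ℝ i).add contDiff_const)

lemma tail_mid (hσ : ∀ l < L, ∀ i, ContDiff ℝ 2 (σ l i)) (hσ' : ∀ l < L, ∀ i t, deriv (σ l i) t ≠ 0)
    (l : ℕ) (hl : l < L) (Ψ : (Fin (d (l+1)) → ℝ) → ℝ) (hΨ : ContDiff ℝ 1 Ψ)
    (hΨ' : ∀ y, fderiv ℝ Ψ y ≠ 0) (V : Matrix (Fin (d (l+1))) (Fin (m l)) ℝ)
    (hV : ∀ v, V.transpose.mulVec v = 0 → v = 0) (y : Fin (m l) → ℝ) :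
    fderiv ℝ (fun y => Ψ (V.mulVec (actv b σ l y) + c l)) y ≠ 0 := by
  have h1 := hasFDerivAt_act (σ l) (fun i => (hσ l hl i).differentiable two_ne_zero) (b l) y
  have h2 := (hasFDerivAt_mulVec h1 V).add_const (c l)
  have h3 := (hΨ.differentiable one_ne_zero (V.mulVec (actv b σ l y) + c l)).hasFDerivAt.comp y h2
  have h4 := h3.fderiv
  change fderiv ℝ (fun y => Ψ (V.mulVec (actv b σ l y) + c l)) y = _ at h4
  rw [h4]
  have hn := functional_comp_ne_zero V hV _ (hΨ' (V.mulVec (actv b σ l y) + c l))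
  intro h0
  apply hn
  ext z
  have := congrArg (fun f : (Fin (m l) → ℝ) →L[ℝ] ℝ =>
    f (fun i => z i / deriv (σ l i) (y i + b l i))) h0
  simp only [ContinuousLinearMap.comp_apply, _root_.zero_apply] at this
  simp only [ContinuousLinearMap.comp_apply, _root_.zero_apply]
  convert this using 4
  funext i
  simp [mul_div_cancel₀, hσ' l hl]

lemma tail_exists (hσ : ∀ l < L, ∀ i, ContDiff ℝ 2 (σ l i))
    (hσ' : ∀ l < L, ∀ i t, deriv (σ l i) t ≠ 0) (J : ℕ) (o : Fin (d L)) (l : ℕ) (hl : l ≤ L) :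
    ∃ Ψ : Wts L d m → (Fin (d l) → ℝ) → ℝ,
      (∀ w x, HH b c σ w L x o = Ψ w (HH b c σ w l x)) ∧
      (∀ w, ContDiff ℝ 1 (Ψ w)) ∧
      (∀ w w', (∀ i : Fin L, l ≤ i → w i = w' i) → Ψ w = Ψ w') ∧
      (∀ w, Gen J w → J ≤ 2 * l → ∀ y, fderiv ℝ (Ψ w) y ≠ 0) := by
  induction hl using Nat.decreasingInduction with
  | self =>
    refine ⟨fun _ y => y o, fun _ _ => rfl, fun _ => contDiff_apply ℝ ℝ o, fun _ _ _ => rfl, ?_⟩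
    intro w _ _ y h0
    have h1 : fderiv ℝ (fun y : Fin (d L) → ℝ => y o) y =
        ContinuousLinearMap.proj (R := ℝ) (φ := fun _ : Fin (d L) => ℝ) o :=
      (ContinuousLinearMap.proj (R := ℝ) (φ := fun _ : Fin (d L) => ℝ) o).hasFDerivAt.fderiv
    rw [h1] at h0
    have := congrArg (fun f : (Fin (d L) → ℝ) →L[ℝ] ℝ => f (fun _ => 1)) h0
    simp at this
  | of_succ l hl ih =>
    obtain ⟨Ψ, h1, h2, h3, h4⟩ := ih
    have hmid : ∀ w, ContDiff ℝ 1 (fun y => Ψ w ((VM w l).mulVec (actv b σ l y) + c l)) := fun w =>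
      (h2 w).comp (((contDiff_mulVec _).comp (contDiff_actv b σ hσ l hl)).add contDiff_const)
    refine ⟨fun w y => Ψ w ((VM w l).mulVec (actv b σ l ((WM w l).mulVec y)) + c l),
      fun w x => by rw [h1, HH_succ], fun w => (hmid w).comp (contDiff_mulVec _), ?_, ?_⟩
    · intro w w' hw
      simp only [h3 w w' fun i hi => hw i (by omega), WM_congr w w' l fun i hi => hw i (by omega),
        VM_congr w w' l fun i hi => hw i (by omega)]
    · intro w hw hJ y
      have g := tail_mid b c σ hσ hσ' l hl (Ψ w) (h2 w) (h4 w hw (by omega)) (VM w l)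
        ((hw l hl).2.2.2 (by omega)) ((WM w l).mulVec y)
      have h5 := ((hmid w).differentiable one_ne_zero ((WM w l).mulVec y)).hasFDerivAt.comp y
        (hasFDerivAt_mulVec (hasFDerivAt_id y) (WM w l))
      have h6 := h5.fderiv
      change fderiv ℝ (fun y => Ψ w ((VM w l).mulVec (actv b σ l ((WM w l).mulVec y)) + c l)) y = _
        at h6
      rw [h6]
      exact functional_comp_ne_zero (WM w l) ((hw l hl).2.1 hJ) _ g

/-- A weight tuple supported in layer `l`. -/
def pert (l : ℕ) (hl : l < L) (δ : Matrix (Fin (m l)) (Fin (d l)) ℝ)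
    (δ' : Matrix (Fin (d (l+1))) (Fin (m l)) ℝ) : Wts L d m :=
  Pi.single ⟨l, hl⟩ (δ, δ')

lemma WM_perturb (w : Wts L d m) (l : ℕ) (hl : l < L) (δ : Matrix (Fin (m l)) (Fin (d l)) ℝ)
    (δ' : Matrix (Fin (d (l+1))) (Fin (m l)) ℝ) (t : ℝ) :
    WM (w + t • pert l hl δ δ') l = WM w l + t • δ := by
  ext i j
  simp [pert, WM, hl, Matrix.smul_apply]
  rfl

lemma VM_perturb (w : Wts L d m) (l : ℕ) (hl : l < L) (δ : Matrix (Fin (m l)) (Fin (d l)) ℝ)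
    (δ' : Matrix (Fin (d (l+1))) (Fin (m l)) ℝ) (t : ℝ) :
    VM (w + t • pert l hl δ δ') l = VM w l + t • δ' := by
  ext i j
  simp [pert, VM, hl, Matrix.smul_apply]
  rfl

lemma ne_perturb (w : Wts L d m) (l : ℕ) (hl : l < L) (δ : Matrix (Fin (m l)) (Fin (d l)) ℝ)
    (δ' : Matrix (Fin (d (l+1))) (Fin (m l)) ℝ) (t : ℝ) (i : Fin L) (hi : (i : ℕ) ≠ l) :
    (w + t • pert l hl δ δ') i = w i := by
  have : i ≠ ⟨l, hl⟩ := fun h => hi (congrArg Fin.val h)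
  simp [pert, Pi.single_eq_of_ne this]

lemma core (hσ : ∀ l < L, ∀ i, ContDiff ℝ 2 (σ l i))
    (hσ' : ∀ l < L, ∀ i t, deriv (σ l i) t ≠ 0) (J : ℕ) (hdL : d L = 1) (o : Fin (d L))
    (w : Wts L d m) (hw : Gen J w) (p ξ : Fin (d 0) → ℝ)
    (hcrit : fderiv ℝ (fun x => HH b c σ w L x o) p = 0)
    (hvar : ∀ e : Wts L d m, HasDerivAt
      (fun t : ℝ => fderiv ℝ (fun x => HH b c σ (w + t • e) L x o) p ξ) 0 0) : ξ = 0 := by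
  have hdiff : ∀ l ≤ L, HasFDerivAt (HH b c σ w l) (fderiv ℝ (HH b c σ w l) p) p := by
    intro l hl
    have h1 := (contDiff_HH b c σ hσ l hl).comp
      (contDiff_prodMk_right w : ContDiff ℝ 2 (fun x : Fin (d 0) → ℝ => (w, x)))
    exact (h1.differentiable two_ne_zero p).hasFDerivAt
  have main : ∀ l ≤ L, fderiv ℝ (HH b c σ w l) p ξ = 0 := by
    intro l hl
    induction hl using Nat.decreasingInduction with
    | self =>
      have h1 := hasFDerivAt_pi'.mp (hdiff L le_rfl) o
      have h2 := h1.fderiv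
      rw [hcrit] at h2
      have h3 := congrArg (fun f : (Fin (d 0) → ℝ) →L[ℝ] ℝ => f ξ) h2
      simp only [ContinuousLinearMap.comp_apply, _root_.zero_apply,
        ContinuousLinearMap.proj_apply] at h3
      funext i
      have : i = o := by
        apply Fin.ext
        have := i.2
        have := o.2
        omega
      rw [this]
      exact h3.symm
    | of_succ l hl ih =>
      obtain ⟨Ψ, t1, t2, t3, t4⟩ := tail_exists b c σ hσ hσ' J o (l+1) hl
      have hH := hdiff l hl.le
      set η := fderiv ℝ (HH b c σ w l) p with hη
      have hWH := hasFDerivAt_mulVec hH (WM w l)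
      have hq := (hasFDerivAt_act (σ l) (fun i => (hσ l hl i).differentiable two_ne_zero) (b l)
        ((WM w l).mulVec (HH b c σ w l p))).comp p hWH
      set q := (ContinuousLinearMap.pi fun i =>
        deriv (σ l i) ((WM w l).mulVec (HH b c σ w l p) i + b l i) •
        (ContinuousLinearMap.proj (R := ℝ) (φ := fun _ : Fin (m l) => ℝ) i)).comp
        ((LinearMap.toContinuousLinearMap (WM w l).mulVecLin).comp η) with hqdef
      change HasFDerivAt (fun x => actv b σ l ((WM w l).mulVec (HH b c σ w l x))) q p at hq
      have hVq : (VM w l).mulVec (q ξ) = 0 := by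
        have h1 := (hasFDerivAt_mulVec hq (VM w l)).add_const (c l)
        have h2 := h1.fderiv
        change fderiv ℝ (HH b c σ w (l+1)) p = _ at h2
        rw [h2] at ih
        exact ih
      have hqξ : q ξ = 0 := by
        by_cases hJ : 2 * l + 1 < J
        · exact (hw l hl).2.2.1 hJ _ hVq
        · refine key_step _ q p ξ hq (fun y => Ψ w (y + c l))
            ((t2 w).comp (contDiff_id.add contDiff_const)) (VM w l) hVq ?_ ?_
          · rw [fderiv_comp_add_right]
            exact t4 w hw (by omega) _
          · intro δ
            have := hvar (pert l hl 0 δ)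
            have hfun : ∀ (t : ℝ) x, HH b c σ (w + t • pert l hl 0 δ) L x o =
                Ψ w ((VM w l + t • δ).mulVec (actv b σ l ((WM w l).mulVec (HH b c σ w l x))) + c l) := by
              intro t x
              have e1 := VM_perturb w l hl 0 δ t
              have e2 := WM_perturb w l hl 0 δ t
              have e3 := ne_perturb w l hl 0 δ t
              rw [t1, HH_succ, e1, e2, HH_congr b c σ _ w l fun i hi => e3 i (by omega),
                t3 _ w fun i hi => e3 i (by omega), smul_zero, add_zero]
            simp only [hfun] at this
            exact this
      have hWη : (WM w l).mulVec (η ξ) = 0 := by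
        funext i
        have := congrFun hqξ i
        simp only [hqdef, ContinuousLinearMap.comp_apply, ContinuousLinearMap.pi_apply,
          smul_apply, ContinuousLinearMap.proj_apply, smul_eq_mul,
          Pi.zero_apply, mul_eq_zero, hσ' l hl, false_or] at this
        exact this
      by_cases hJ : 2 * l < J
      · exact (hw l hl).1 hJ _ hWη
      · refine key_step _ η p ξ hH (fun y => Ψ w ((VM w l).mulVec (actv b σ l y) + c l))
          ((t2 w).comp (((contDiff_mulVec _).comp (contDiff_actv b σ hσ l hl)).add contDiff_const))
          (WM w l) hWη (tail_mid b c σ hσ hσ' l hl (Ψ w) (t2 w) (t4 w hw (by omega)) (VM w l)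
            ((hw l hl).2.2.2 (by omega)) _) ?_
        intro δ
        have := hvar (pert l hl δ 0)
        have hfun : ∀ (t : ℝ) x, HH b c σ (w + t • pert l hl δ 0) L x o =
            Ψ w ((VM w l).mulVec (actv b σ l ((WM w l + t • δ).mulVec (HH b c σ w l x))) + c l) := by
          intro t x
          have e1 := VM_perturb w l hl δ 0 t
          have e2 := WM_perturb w l hl δ 0 t
          have e3 := ne_perturb w l hl δ 0 t
          rw [t1, HH_succ, e1, e2, HH_congr b c σ _ w l fun i hi => e3 i (by omega),
            t3 _ w fun i hi => e3 i (by omega), smul_zero, add_zero]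
        simp only [hfun] at this
        exact this
  have h0 := main 0 (Nat.zero_le _)
  have : fderiv ℝ (HH b c σ w 0) p = ContinuousLinearMap.id ℝ _ :=
    (hasFDerivAt_id p).fderiv
  rw [this] at h0
  exact h0

end MLPMorse

lemma haar_mat (a b : ℕ) : (volume : Measure (Fin a → Fin b → ℝ)).IsAddHaarMeasure := by
  have := fun i : Fin a => (inferInstance : (volume : Measure (Fin b → ℝ)).IsAddHaarMeasure)
  have : MeasurableAdd (Fin b → ℝ) := inferInstance
  exact Measure.pi.isAddHaarMeasure (ι := Fin a) (fun _ : Fin a => (volume : Measure (Fin b → ℝ)))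

lemma haar_weights (L : ℕ) (d m : ℕ → ℕ) : (volume : Measure (Wts L d m)).IsAddHaarMeasure := by
  have h2 : ∀ l : Fin L, (volume : Measure ((Fin (m l) → Fin (d l) → ℝ) ×
      (Fin (d (l+1)) → Fin (m l) → ℝ))).IsAddHaarMeasure := by
    intro l
    have h1 := haar_mat (m l) (d l)
    have h2 := haar_mat (d (l+1)) (m l)
    have : MeasurableAdd (Fin (m l) → Fin (d l) → ℝ) := inferInstance
    have : MeasurableAdd (Fin (d (l+1)) → Fin (m l) → ℝ) := inferInstance
    exact Measure.prod.instIsAddHaarMeasure volume volume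
  have h3 : ∀ l : Fin L, MeasurableAdd ((Fin (m l) → Fin (d l) → ℝ) ×
      (Fin (d (l+1)) → Fin (m l) → ℝ)) := fun l => inferInstance
  exact Measure.pi.isAddHaarMeasure (ι := Fin L) (fun l : Fin L =>
    (volume : Measure ((Fin (m l) → Fin (d l) → ℝ) × (Fin (d (l+1)) → Fin (m l) → ℝ))))

lemma ae_inj' {E : Type*} [NormedAddCommGroup E] [NormedSpace ℝ E] [FiniteDimensional ℝ E]
    [MeasurableSpace E] [BorelSpace E] (μ : Measure E) [μ.IsAddHaarMeasure]
    {m n : ℕ} (hnm : n ≤ m) (f : E → Matrix (Fin m) (Fin n) ℝ)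
    (π : E →ₗ[ℝ] (Fin m → Fin n → ℝ)) (hf : ∀ w, f w = Matrix.of (π w))
    (hπ : Function.Surjective π) :
    ∀ᵐ w ∂μ, ∀ v, (f w).mulVec v = 0 → v = 0 := by
  have := ae_injective μ hnm (LinearMap.toContinuousLinearMap π) hπ
  rw [ae_iff]
  refine measure_mono_null ?_ this
  intro w hw
  simp only [Set.mem_ofPred_eq, not_forall] at hw
  obtain ⟨v, hv, hv0⟩ := hw
  refine ⟨v, hv0, ?_⟩
  rw [hf] at hv
  exact hv

/-- transposition as a linear map on plain arrays -/
def trL (a b : ℕ) : (Fin a → Fin b → ℝ) →ₗ[ℝ] (Fin b → Fin a → ℝ) where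
  toFun A := fun j i => A i j
  map_add' _ _ := rfl
  map_smul' _ _ := rfl

lemma trL_surj (a b : ℕ) : Function.Surjective (trL a b) := fun A => ⟨fun i j => A j i, rfl⟩

lemma ae_gen (L : ℕ) (d m : ℕ → ℕ) (J : ℕ)
    (h1 : ∀ l < L, 2 * l < J → d l ≤ m l) (h2 : ∀ l < L, J ≤ 2 * l → m l ≤ d l)
    (h3 : ∀ l < L, 2 * l + 1 < J → m l ≤ d (l+1))
    (h4 : ∀ l < L, J ≤ 2 * l + 1 → d (l+1) ≤ m l) :
    ∀ᵐ w : Wts L d m, Gen J w := by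
  have := haar_weights L d m
  unfold Gen
  rw [ae_all_iff]
  intro l
  rw [Filter.eventually_imp_distrib_left]
  intro hl
  let P1 : Wts L d m →ₗ[ℝ] (Fin (m l) → Fin (d l) → ℝ) :=
    (LinearMap.fst ℝ _ _).comp (LinearMap.proj (R := ℝ) (φ := fun l : Fin L =>
        (Fin (m l) → Fin (d l) → ℝ) × (Fin (d (l+1)) → Fin (m l) → ℝ)) ⟨l, hl⟩)
  let P2 : Wts L d m →ₗ[ℝ] (Fin (d (l+1)) → Fin (m l) → ℝ) :=
    (LinearMap.snd ℝ _ _).comp (LinearMap.proj (R := ℝ) (φ := fun l : Fin L =>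
        (Fin (m l) → Fin (d l) → ℝ) × (Fin (d (l+1)) → Fin (m l) → ℝ)) ⟨l, hl⟩)
  have hP1 : Function.Surjective P1 := fun A =>
    ⟨Pi.single ⟨l, hl⟩ (A, 0), by simp [P1]⟩
  have hP2 : Function.Surjective P2 := fun A =>
    ⟨Pi.single ⟨l, hl⟩ (0, A), by simp [P2]⟩
  have e1 : ∀ w : Wts L d m, WM w l = Matrix.of (P1 w) := fun w => by simp [WM, hl, P1]
  have e2 : ∀ w : Wts L d m, VM w l = Matrix.of (P2 w) := fun w => by simp [VM, hl, P2]
  refine Filter.Eventually.and ?_ (Filter.Eventually.and ?_ (Filter.Eventually.and ?_ ?_))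
  · rw [Filter.eventually_imp_distrib_left]
    intro hJ
    exact ae_inj' volume (h1 l hl hJ) _ P1 e1 hP1
  · rw [Filter.eventually_imp_distrib_left]
    intro hJ
    exact ae_inj' volume (h2 l hl hJ) _ ((trL _ _).comp P1) (fun w => by rw [e1]; rfl)
      ((trL_surj _ _).comp hP1)
  · rw [Filter.eventually_imp_distrib_left]
    intro hJ
    exact ae_inj' volume (h3 l hl hJ) _ P2 e2 hP2
  · rw [Filter.eventually_imp_distrib_left]
    intro hJ
    exact ae_inj' volume (h4 l hl hJ) _ ((trL _ _).comp P2) (fun w => by rw [e2]; rfl)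
      ((trL_surj _ _).comp hP2)

/-- A subspace of the dual of `ℝ^n` that is not everything is annihilated by a nonzero vector. -/
lemma dual_annihilator {n : ℕ} (S : Submodule ℝ ((Fin n → ℝ) →L[ℝ] ℝ))
    (h : ∀ ξ : Fin n → ℝ, (∀ φ ∈ S, φ ξ = 0) → ξ = 0) : S = ⊤ := by
  by_contra hS
  obtain ⟨f, hf, hfS⟩ := Submodule.exists_le_ker_of_lt_top S (lt_top_iff_ne_top.mpr hS)
  let ξ : Fin n → ℝ := fun i => f (ContinuousLinearMap.proj (R := ℝ) (φ := fun _ : Fin n => ℝ) i)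
  have hexp : ∀ φ : (Fin n → ℝ) →L[ℝ] ℝ, f φ = φ ξ := by
    intro φ
    have h1 : φ = ∑ i, φ (Pi.single i 1) •
        (ContinuousLinearMap.proj (R := ℝ) (φ := fun _ : Fin n => ℝ) i) := by
      ext y
      conv_lhs => rw [pi_eq_sum_univ' y]
      rw [map_sum]
      simp [mul_comm]
    have h2 : φ ξ = ∑ i, φ (Pi.single i 1) * ξ i := by
      conv_lhs => rw [h1]
      simp
    rw [h2]
    conv_lhs => rw [h1]
    rw [map_sum]
    simp [ξ]
  have h0 := h ξ fun φ hφ => by rw [← hexp]; exact hfS hφ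
  apply hf
  ext φ
  rw [hexp, h0]
  simp

lemma null_degenerate {L : ℕ} {d m : ℕ → ℕ} (b : ∀ l : ℕ, Fin (m l) → ℝ)
    (c : ∀ l : ℕ, Fin (d (l+1)) → ℝ) (σ : ∀ l : ℕ, Fin (m l) → ℝ → ℝ)
    (hσ : ∀ l < L, ∀ i, ContDiff ℝ 2 (σ l i))
    (hσ' : ∀ l < L, ∀ i t, deriv (σ l i) t ≠ 0) (J : ℕ) (hdL : d L = 1) (o : Fin (d L))
    (hgen : ∀ᵐ w : Wts L d m, Gen J w) :
    volume {w : Wts L d m | ∃ p : Fin (d 0) → ℝ,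
      fderiv ℝ (fun x => HH b c σ w L x o) p = 0 ∧
      (hessPi (fun x => HH b c σ w L x o) p).det = 0} = 0 := by
  have := haar_weights L d m
  let Φ : Wts L d m × (Fin (d 0) → ℝ) → ℝ := fun z => HH b c σ z.1 L z.2 o
  have hΦ : ContDiff ℝ 2 Φ := contDiff_pi.mp (contDiff_HH b c σ hσ L le_rfl) o
  let F : Wts L d m × (Fin (d 0) → ℝ) → ((Fin (d 0) → ℝ) →L[ℝ] ℝ) := fun z =>
    (fderiv ℝ Φ z).comp (ContinuousLinearMap.inr ℝ _ _)
  have hF : ContDiff ℝ 1 F :=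
    (hΦ.fderiv_right (m := 1) (by norm_num)).clm_comp contDiff_const
  have hFeq : ∀ w x, F (w, x) = fderiv ℝ (fun x => HH b c σ w L x o) x := by
    intro w x
    have h1 := ((hΦ.differentiable two_ne_zero) (w, x)).hasFDerivAt.comp x
      (hasFDerivAt_prodMk_right w x)
    exact h1.fderiv.symm
  have hS := param_sard (volume : Measure (Wts L d m)) (X := Fin (d 0) → ℝ)
    (Y := (Fin (d 0) → ℝ) →L[ℝ] ℝ)
    (by rw [← (LinearMap.toContinuousLinearMap (𝕜 := ℝ) (E := Fin (d 0) → ℝ)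
          (F' := ℝ)).finrank_eq]
        exact (Subspace.dual_finrank_eq (K := ℝ) (V := Fin (d 0) → ℝ)).symm) F hF
  rw [ae_iff] at hgen
  refine measure_mono_null ?_ (measure_union_null hgen hS)
  rintro w ⟨p, hp, hdet⟩
  by_cases hw : Gen J w
  swap
  · exact Or.inl hw
  right
  refine ⟨p, by rw [hFeq, hp], ?_, ?_⟩
  · apply dual_annihilator
    intro ξ hξ
    refine core b c σ hσ hσ' J hdL o w hw p ξ hp fun e => ?_
    have h1 : HasDerivAt (fun t : ℝ => (w + t • e, p)) (e, (0 : Fin (d 0) → ℝ)) 0 := by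
      have h2 : HasDerivAt (fun t : ℝ => w + t • e) e 0 := by
        simpa using ((hasDerivAt_id (0 : ℝ)).smul_const e).const_add w
      exact h2.prodMk (hasDerivAt_const _ _)
    have h3 : HasFDerivAt F (fderiv ℝ F (w, p)) (w + (0 : ℝ) • e, p) := by
      rw [zero_smul, add_zero]
      exact (hF.differentiable one_ne_zero (w, p)).hasFDerivAt
    have h4 := h3.comp_hasDerivAt (0 : ℝ) h1
    have h5 := h4.clm_apply (hasDerivAt_const (0 : ℝ) ξ)
    have h6 := hξ (fderiv ℝ F (w, p) (e, 0)) ⟨(e, 0), rfl⟩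
    simp only [Function.comp_def, hFeq, h6, map_zero, add_zero] at h5
    exact h5
  · obtain ⟨v, hv, hv0⟩ := Matrix.exists_vecMul_eq_zero_iff.mpr hdet
    refine ⟨v, hv, ?_⟩
    have h1 := ((hF.differentiable one_ne_zero) (w, p)).hasFDerivAt.comp p
      (hasFDerivAt_prodMk_right w p)
    have h2 := h1.fderiv
    have h3 : (F ∘ fun x => (w, x)) = fderiv ℝ (fun x => HH b c σ w L x o) :=
      funext fun x => hFeq w x
    rw [h3] at h2
    have h4 : fderiv ℝ F (w, p) (0, v) =
        fderiv ℝ (fderiv ℝ (fun x => HH b c σ w L x o)) p v := by rw [h2]; rfl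
    rw [h4]
    have h5 : ∀ j, fderiv ℝ (fderiv ℝ (fun x => HH b c σ w L x o)) p v (Pi.single j 1) = 0 := by
      intro j
      have := congrFun hv0 j
      conv_lhs => rw [pi_eq_sum_univ' v]
      rw [map_sum, sum_apply]
      simpa [Matrix.vecMul, dotProduct, hessPi, iteratedFDeriv_two_apply] using this
    ext y
    rw [pi_eq_sum_univ' y, map_sum]
    simp [h5]

/-- **Almost every augmented scalar MLP is Morse (class (C1) or (C2)).**
For an augmented architecture (the interleaved width sequence `d 0, m 0, d 1, …, d L`
attains a maximum strictly larger than `d 0`, is non-decreasing before it and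
non-increasing after it), with fixed biases and strictly monotone `C^k` activations with
nowhere-vanishing derivative, the set of weight-matrix tuples producing a map with a
degenerate critical point is a Lebesgue null set. -/
theorem augmented_scalar_MLP_ae_Morse
    (k L : ℕ) (hk : 2 ≤ k) (hL : 1 ≤ L)
    (d m : ℕ → ℕ) (hdL : d L = 1)
    (b : ∀ l : ℕ, Fin (m l) → ℝ) (c : ∀ l : ℕ, Fin (d (l+1)) → ℝ)
    (σ : ∀ l : ℕ, Fin (m l) → ℝ → ℝ)
    (hσ : ∀ l < L, ∀ i, ContDiff ℝ k (σ l i) ∧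
      (StrictMono (σ l i) ∨ StrictAnti (σ l i)) ∧ ∀ t : ℝ, deriv (σ l i) t ≠ 0)
    (width : ℕ → ℕ)
    (hwidth : ∀ i, width i = if i % 2 = 0 then d (i / 2) else m (i / 2))
    (jmax : ℕ) (hjm : jmax ≤ 2 * L)
    (haug : d 0 < width jmax)
    (hup : ∀ i < jmax, width i ≤ width (i+1))
    (hdown : ∀ i, jmax ≤ i → i < 2 * L → width (i+1) ≤ width i) :
    MeasureTheory.volume
      {w : ∀ l : Fin L, (Fin (m l) → Fin (d l) → ℝ) × (Fin (d (l+1)) → Fin (m l) → ℝ) |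
        ∃ p : Fin (d 0) → ℝ,
          fderiv ℝ (fun x => mlpMap d m
            (fun l => if h : l < L then Matrix.of (w ⟨l, h⟩).1 else 0)
            (fun l => if h : l < L then Matrix.of (w ⟨l, h⟩).2 else 0)
            b c σ L x ⟨0, by omega⟩) p = 0 ∧
          (hessPi (fun x => mlpMap d m
            (fun l => if h : l < L then Matrix.of (w ⟨l, h⟩).1 else 0)
            (fun l => if h : l < L then Matrix.of (w ⟨l, h⟩).2 else 0)
            b c σ L x ⟨0, by omega⟩) p).det = 0} = 0 := by
  have hg := ae_gen L d m jmax
    (by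
      intro l hl h
      have := hup (2 * l) h
      rw [hwidth, hwidth] at this
      simpa [Nat.add_mod, Nat.add_div, show (2 * l + 1) / 2 = l by omega] using this)
    (by
      intro l hl h
      have := hdown (2 * l) h (by omega)
      rw [hwidth, hwidth] at this
      simpa [Nat.add_mod, show (2 * l + 1) / 2 = l by omega] using this)
    (by
      intro l hl h
      have := hup (2 * l + 1) h
      rw [hwidth, hwidth] at this
      simpa [Nat.add_mod, show (2 * l + 1) / 2 = l by omega,
        show (2 * l + 1 + 1) / 2 = l + 1 by omega] using this)
    (by
      intro l hl h
      have := hdown (2 * l + 1) h (by omega)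
      rw [hwidth, hwidth] at this
      simpa [Nat.add_mod, show (2 * l + 1) / 2 = l by omega,
        show (2 * l + 1 + 1) / 2 = l + 1 by omega] using this)
  exact null_degenerate b c σ
    (fun l hl i => (hσ l hl i).1.of_le (by exact_mod_cast hk))
    (fun l hl i t => (hσ l hl i).2.2 t) jmax hdL ⟨0, by omega⟩ hg
end

section
/- Let k ≥ 2 and consider a degenerate scalar neural ODE, i.e., one in which at least one of the weight matrices W ∈ ℝ^{m×d} or W̃ ∈ ℝ^{1×m} does not have full rank, with vector field f : [0,T]×ℝ^m → ℝ^m continuous in the first variable and k times continuously differentiable in the second variable, and with unique solvability of the initial value problems on [0,T]. Then the input–output map Φ(x) = W̃·h_x(T) + b̃ is of class (C1) or of class (C3); equivalently, Φ is never of class (C2): if Φ has a critical point, then Φ has a degenerate critical point. -/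
/-- A function on `ℝ^n` which is invariant under translations along a nonzero vector `v`
has a singular Hessian everywhere. -/
theorem hessPi_det_eq_zero_of_invariant {n : ℕ} (f : (Fin n → ℝ) → ℝ) (v : Fin n → ℝ)
    (hv : v ≠ 0) (hinv : ∀ (x : Fin n → ℝ) (s : ℝ), f (x + s • v) = f x) (p : Fin n → ℝ) :
    (hessPi f p).det = 0 := by
  -- the derivative of `f` is invariant along `v` as well
  have h1 : ∀ (x : Fin n → ℝ) (s : ℝ), fderiv ℝ f (x + s • v) = fderiv ℝ f x := by
    intro x s
    rw [← fderiv_comp_add_right (s • v)]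
    congr 1
    funext y
    exact hinv y s
  -- hence the second derivative vanishes in direction `v`
  have h2 : fderiv ℝ (fderiv ℝ f) p v = 0 := by
    by_cases hd : DifferentiableAt ℝ (fderiv ℝ f) p
    · rw [← hd.lineDeriv_eq_fderiv]
      simp [lineDeriv, h1]
    · rw [fderiv_zero_of_not_differentiableAt hd]
      rfl
  apply Matrix.exists_vecMul_eq_zero_iff.mp
  refine ⟨v, hv, ?_⟩
  funext j
  have h3 : v = ∑ i, v i • (Pi.single i (1 : ℝ) : Fin n → ℝ) := by
    funext l
    simp [Finset.sum_apply, Pi.single_apply]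
  have h4 : fderiv ℝ (fderiv ℝ f) p v (Pi.single j 1) = 0 := by rw [h2]; rfl
  rw [h3] at h4
  simp only [map_sum, map_smul, ContinuousLinearMap.sum_apply,
    ContinuousLinearMap.smul_apply, smul_eq_mul] at h4
  simp only [Matrix.vecMul, dotProduct, hessPi, Matrix.of_apply, iteratedFDeriv_two_apply,
    Matrix.cons_val_zero, Matrix.cons_val_one, Pi.zero_apply]
  exact h4

/-- **Degenerate scalar neural ODEs are of class (C1) or (C3), never (C2).**
If one of the weight matrices `W ∈ ℝ^{m×d}`, `Wt ∈ ℝ^{1×m}` fails to have full rank, then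
the input-output map `Φ(x) = Wt ⬝ sol (W x + b) T + bt` of the neural ODE either has no
critical point, or it has a degenerate critical point. -/
theorem degenerate_scalar_neural_ODE_C1_or_C3
    (d m k : ℕ) (hk : 2 ≤ k) (hd : 1 ≤ d) (hm1 : 1 ≤ m)
    (T : ℝ) (hT : 0 < T)
    (W : Matrix (Fin m) (Fin d) ℝ) (Wt : Fin m → ℝ)
    (hdeg : W.rank ≠ min m d ∨ Wt = 0)
    (b : Fin m → ℝ) (bt : ℝ)
    (f : ℝ → (Fin m → ℝ) → (Fin m → ℝ))
    (hfc : ∀ y : Fin m → ℝ, ContinuousOn (fun t => f t y) (Set.Icc 0 T))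
    (hfk : ∀ t ∈ Set.Icc (0:ℝ) T, ContDiff ℝ k (f t))
    (sol : (Fin m → ℝ) → ℝ → (Fin m → ℝ))
    (hsol0 : ∀ y, sol y 0 = y)
    (hsol : ∀ y, ∀ t ∈ Set.Icc (0:ℝ) T, HasDerivAt (sol y) (f t (sol y t)) t)
    (huniq : ∀ (y : Fin m → ℝ) (g : ℝ → Fin m → ℝ), g 0 = y →
      (∀ t ∈ Set.Icc (0:ℝ) T, HasDerivAt g (f t (g t)) t) →
      ∀ t ∈ Set.Icc (0:ℝ) T, g t = sol y t) :
    (∃ p : Fin d → ℝ,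
        fderiv ℝ (fun x : Fin d → ℝ => (∑ i, Wt i * sol (W.mulVec x + b) T i) + bt) p = 0) →
    ∃ p : Fin d → ℝ,
      fderiv ℝ (fun x : Fin d → ℝ => (∑ i, Wt i * sol (W.mulVec x + b) T i) + bt) p = 0 ∧
      (hessPi (fun x : Fin d → ℝ => (∑ i, Wt i * sol (W.mulVec x + b) T i) + bt) p).det = 0 := by
  rintro ⟨p, hp⟩
  refine ⟨p, hp, ?_⟩
  rcases hdeg with hW | hWt
  · -- `W` has a nontrivial kernel
    have hker : ∃ v : Fin d → ℝ, v ≠ 0 ∧ W.mulVec v = 0 := by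
      by_contra hcon
      push Not at hcon
      have hle : W.rank ≤ min m d :=
        le_min (by simpa using W.rank_le_height) (by simpa using W.rank_le_width)
      have hinj : Function.Injective W.mulVecLin := by
        rw [injective_iff_map_eq_zero]
        intro v hv
        by_contra hne
        exact hcon v hne hv
      have hr : W.rank = d := by
        rw [Matrix.rank, LinearMap.finrank_range_of_inj hinj]
        simp
      have := min_le_right m d
      omega
    obtain ⟨v, hv, hWv⟩ := hker
    refine hessPi_det_eq_zero_of_invariant _ v hv ?_ p
    intro x s
    simp only [Matrix.mulVec_add, Matrix.mulVec_smul, hWv, smul_zero, add_zero]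
  · -- the input-output map is constant
    refine hessPi_det_eq_zero_of_invariant _ (Pi.single ⟨0, hd⟩ 1) ?_ ?_ p
    · simp
    · intro x s
      simp [hWt]
end
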